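/- Let P = (ω^ω, ρ, ȳ) be any presentation of Baire space ω^ω where ρ is the standard ultrametric. Then for every countable ordinal α there exists a discrete countable closed subset F ⊆ ω^ω with φ_P(F) = α. -/

import Mathlib

open Set Filter Topology

/-- A presentation `(X, d, x̄)` of a Polish space `X`: a complete metric `d`
compatible with the topology of `X`, together with a dense sequence `x̄`. -/
structure Presentation (X : Type) [TopologicalSpace X] where
  dist : X → X → ℝ
  seq : ℕ → X
  dist_self : ∀ x, dist x x = 0
  eq_of_dist_eq_zero : ∀ x y, dist x y = 0 → x = y
  dist_comm : ∀ x y, dist x y = dist y x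
  dist_triangle : ∀ x y z, dist x z ≤ dist x y + dist y z
  /-- `d` is compatible with the topology of `X`. -/
  isOpen_iff : ∀ s : Set X, IsOpen s ↔ ∀ x ∈ s, ∃ ε > 0, ∀ y, dist y x < ε → y ∈ s
  /-- `d` is complete. -/
  complete : ∀ u : ℕ → X, (∀ ε > 0, ∃ N, ∀ m ≥ N, ∀ n ≥ N, dist (u m) (u n) < ε) →
      ∃ x, ∀ ε > 0, ∃ N, ∀ n ≥ N, dist (u n) x < ε
  /-- the sequence `x̄` is dense. -/
  dense : ∀ x, ∀ ε > 0, ∃ i, dist x (seq i) < ε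

namespace Presentation

variable {X : Type} [TopologicalSpace X] (P : Presentation X)

/-- The open ball `B_P(n)`. -/
def ball (n : ℕ × ℕ) : Set X := {x | P.dist x (P.seq n.1) < (1/2 : ℝ) ^ (n.2 + 1)}

/-- The closed ball `B̄_P(n)`. -/
def cball (n : ℕ × ℕ) : Set X := {x | P.dist x (P.seq n.1) ≤ (1/2 : ℝ) ^ (n.2 + 1)}

/-- The relation `n ≺_P m`. -/
def prec (n m : ℕ × ℕ) : Prop := n.2 < m.2 ∧ P.cball m ⊆ P.ball n

/-- The relation `n ⋏_P m`. -/
def apart (n m : ℕ × ℕ) : Prop := P.cball n ∩ P.cball m = ∅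

/-- The code `A_F^P` of a closed set `F ⊆ X`. -/
def code (F : Set X) : Set (ℕ × ℕ) := {n | (P.ball n ∩ F).Nonempty}

/-- The derivative `D_P` on subsets of `ω × ω`. -/
def deriv (A : Set (ℕ × ℕ)) : Set (ℕ × ℕ) :=
  {n ∈ A | ∃ u ∈ A, ∃ v ∈ A, P.prec n u ∧ P.prec n v ∧ P.apart u v}

/-- The transfinite iterates `D_P^α(A)`. -/
noncomputable def derivIter (A : Set (ℕ × ℕ)) (α : Ordinal.{0}) : Set (ℕ × ℕ) :=
  Ordinal.limitRecOn α A (fun _ ih => P.deriv ih)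
    (fun o _ ih => ⋂ (β : {β : Ordinal.{0} // β < o}), ih β.1 β.2)

/-- The rank `|A|_P`: the least ordinal `α` with `D_P^α(A) = D_P^{α+1}(A)`. -/
noncomputable def rankA (A : Set (ℕ × ℕ)) : Ordinal.{0} :=
  sInf {α | P.derivIter A (α + 1) = P.derivIter A α}

/-- The rank `φ_P(F) = |A_F^P|_P` of a (countable closed) subset `F ⊆ X`. -/
noncomputable def phi (F : Set X) : Ordinal.{0} := P.rankA (P.code F)

/-- `A ⊆ ω × ω` is `P`-closed. -/
def PClosed (A : Set (ℕ × ℕ)) : Prop := ∀ n ∈ A, ∀ m, P.prec m n → m ∈ A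

/-- `A ⊆ ω × ω` is `P`-pruned. -/
def PPruned (A : Set (ℕ × ℕ)) : Prop := ∀ n ∈ A, ∃ m ∈ A, P.prec n m

/-- `A ⊆ ω × ω` is `P`-perfect. -/
def PPerfect (A : Set (ℕ × ℕ)) : Prop :=
  ∀ n ∈ A, ∃ u ∈ A, ∃ v ∈ A, P.prec n u ∧ P.prec n v ∧ P.apart u v

/-- The set `[A]_P` of `P`-compatible sequences lying in `A`. -/
def body (A : Set (ℕ × ℕ)) : Set (ℕ → ℕ × ℕ) :=
  {f | (∀ i, P.prec (f i) (f (i + 1))) ∧ ∀ i, f i ∈ A}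

/-- The set `F_A^P = π_P([A]_P)`: the points obtained as the unique point of
`⋂_i B_P(n_i)` for a `P`-compatible sequence `(n_i)` in `A`. -/
def limitSet (A : Set (ℕ × ℕ)) : Set X :=
  {x | ∃ f ∈ P.body A, ∀ i, x ∈ P.ball (f i)}

end Presentation

section CB

variable {X : Type} [TopologicalSpace X]

/-- The Cantor–Bendixson derivative: the set of limit points of `F` in `F`. -/
def cbDeriv (F : Set X) : Set X := {x ∈ F | AccPt x (𝓟 F)}

/-- The iterated Cantor–Bendixson derivatives `F^α`. -/
noncomputable def cbIter (F : Set X) (α : Ordinal.{0}) : Set X :=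
  Ordinal.limitRecOn α F (fun _ ih => cbDeriv ih)
    (fun o _ ih => ⋂ (β : {β : Ordinal.{0} // β < o}), ih β.1 β.2)

/-- The Cantor–Bendixson rank `|F|_CB`. -/
noncomputable def cbRank (F : Set X) : Ordinal.{0} :=
  sInf {α | cbIter F (α + 1) = cbIter F α}

/-- The `K_σ`-derivative of a subset `A ⊆ X`: the points of `A` having no open
neighborhood in the subspace `A` whose closure in `A` is compact. -/
def kDeriv (A : Set X) : Set X :=
  {x ∈ A | ∀ U : Set X, IsOpen U → x ∈ U → ¬ IsCompact (A ∩ closure (U ∩ A))}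

/-- The iterated `K_σ`-derivatives `X_α` of the space `X`. -/
noncomputable def kIter (X : Type) [TopologicalSpace X] (α : Ordinal.{0}) : Set X :=
  Ordinal.limitRecOn α Set.univ (fun _ ih => kDeriv ih)
    (fun o _ ih => ⋂ (β : {β : Ordinal.{0} // β < o}), ih β.1 β.2)

/-- The `K_σ`-rank `|X|_{K_σ}`. -/
noncomputable def kRank (X : Type) [TopologicalSpace X] : Ordinal.{0} :=
  sInf {α | kIter X (α + 1) = kIter X α}

end CB

open Classical in
/-- The standard ultrametric on Baire space `ℕ → ℕ`:
`ρ(x,y) = 2^{-min{n : x n ≠ y n} - 1}` for `x ≠ y`, and `0` otherwise. -/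
noncomputable def baireDist (x y : ℕ → ℕ) : ℝ :=
  if h : x = y then 0
  else (1 / 2 : ℝ) ^ (Nat.find (show ∃ n, x n ≠ y n by
    by_contra hc
    push_neg at hc
    exact h (funext hc)) + 1)

theorem baireDist_lt_iff (x y : ℕ → ℕ) (k : ℕ) :
    baireDist x y < (1 / 2 : ℝ) ^ (k + 1) ↔ ∀ i < k + 1, x i = y i := by
  classical
  unfold baireDist
  split_ifs with h
  · subst h; simp
  · rw [pow_lt_pow_iff_right_of_lt_one₀ (by norm_num) (by norm_num), add_lt_add_iff_right,
      Nat.lt_find_iff]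
    simp

theorem baireDist_le_iff (x y : ℕ → ℕ) (k : ℕ) :
    baireDist x y ≤ (1 / 2 : ℝ) ^ (k + 1) ↔ ∀ i < k, x i = y i := by
  classical
  unfold baireDist
  split_ifs with h
  · subst h; simp
  · rw [pow_le_pow_iff_right_of_lt_one₀ (by norm_num) (by norm_num), add_le_add_iff_right,
      Nat.le_find_iff]
    simp

namespace Presentation

section Iterates

variable {X : Type} [TopologicalSpace X] (P : Presentation X)

theorem derivIter_zero (A : Set (ℕ × ℕ)) : P.derivIter A 0 = A := by
  unfold derivIter
  exact Ordinal.limitRecOn_zero ..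

theorem derivIter_add_one (A : Set (ℕ × ℕ)) (γ : Ordinal.{0}) :
    P.derivIter A (γ + 1) = P.deriv (P.derivIter A γ) := by
  unfold derivIter
  exact Ordinal.limitRecOn_add_one ..

theorem derivIter_limit (A : Set (ℕ × ℕ)) {γ : Ordinal.{0}} (h : Order.IsSuccLimit γ) :
    P.derivIter A γ = ⋂ β : {β : Ordinal.{0} // β < γ}, P.derivIter A β.1 := by
  unfold derivIter
  exact Ordinal.limitRecOn_limit _ _ _ _ h

theorem deriv_subset (A : Set (ℕ × ℕ)) : P.deriv A ⊆ A := fun _ h => h.1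

theorem deriv_mono {A B : Set (ℕ × ℕ)} (h : A ⊆ B) : P.deriv A ⊆ P.deriv B := by
  rintro n ⟨hn, u, hu, v, hv, huv⟩
  exact ⟨h hn, u, h hu, v, h hv, huv⟩

/-- A description of the iterates that is uniform in zero, successor and limit ordinals. -/
theorem mem_derivIter_iff (A : Set (ℕ × ℕ)) (γ : Ordinal.{0}) (n : ℕ × ℕ) :
    n ∈ P.derivIter A γ ↔ n ∈ A ∧ ∀ β < γ, n ∈ P.deriv (P.derivIter A β) := by
  induction γ using Ordinal.limitRecOn with
  | zero => simp [derivIter_zero]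
  | add_one γ ih =>
    rw [derivIter_add_one]
    constructor
    · intro h
      have h' := ih.1 (P.deriv_subset _ h)
      refine ⟨h'.1, fun β hβ => ?_⟩
      rcases (Order.lt_add_one_iff.1 hβ).lt_or_eq with hlt | rfl
      · exact h'.2 β hlt
      · exact h
    · exact fun h => h.2 γ (Order.lt_add_one_iff.2 le_rfl)
  | limit γ hγ ih =>
    rw [derivIter_limit P A hγ, Set.mem_iInter]
    constructor
    · intro h
      have h0 : (0 : Ordinal) < γ := hγ.bot_lt
      refine ⟨((ih 0 h0).1 (h ⟨0, h0⟩)).1, fun β hβ => ?_⟩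
      have := h ⟨β + 1, hγ.add_one_lt hβ⟩
      rwa [derivIter_add_one] at this
    · rintro h ⟨β, hβ⟩
      exact P.deriv_subset _ (h.2 β hβ)

theorem derivIter_subset_of_stable (A : Set (ℕ × ℕ)) {β : Ordinal.{0}}
    (h : P.derivIter A (β + 1) = P.derivIter A β) (γ : Ordinal.{0}) :
    P.derivIter A β ⊆ P.derivIter A γ := by
  induction γ using WellFoundedLT.induction with
  | ind γ ih =>
    intro n hn
    refine (P.mem_derivIter_iff A γ n).2 ⟨((P.mem_derivIter_iff A β n).1 hn).1, fun δ hδ => ?_⟩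
    rw [← h, derivIter_add_one] at hn
    exact P.deriv_mono (ih δ hδ) hn

theorem rankA_eq_of_empty (A : Set (ℕ × ℕ)) {α : Ordinal.{0}} (h : P.derivIter A α = ∅)
    (hlt : ∀ β < α, (P.derivIter A β).Nonempty) : P.rankA A = α := by
  refine IsLeast.csInf_eq ⟨?_, fun β hβ => ?_⟩
  · change P.derivIter A (α + 1) = P.derivIter A α
    rw [derivIter_add_one, h]
    exact Set.subset_empty_iff.1 (P.deriv_subset ∅)
  · by_contra hc
    obtain ⟨n, hn⟩ := hlt β (not_le.1 hc)
    have := P.derivIter_subset_of_stable A hβ α hn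
    simp [h] at this

end Iterates

end Presentation

/-- The node `x↾k` belongs to the `γ`-th iterate of the derivative, computed on finite
strings, of the tree of `F`. -/
def NodeMem (F : Set (ℕ → ℕ)) (γ : Ordinal.{0}) (x : ℕ → ℕ) (k : ℕ) : Prop :=
  (∃ y ∈ F, ∀ i < k, y i = x i) ∧
    ∀ β, β < γ → ∃ u v : ℕ → ℕ, ∃ p q : ℕ, k ≤ p ∧ k ≤ q ∧ (∀ i < k, u i = x i) ∧
      (∀ i < k, v i = x i) ∧ (¬ ∀ i < min p q, u i = v i) ∧
      NodeMem F β u (p + 1) ∧ NodeMem F β v (q + 1)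
termination_by γ

namespace NodeMem

variable {F : Set (ℕ → ℕ)} {γ δ : Ordinal.{0}} {x y : ℕ → ℕ} {j k : ℕ}

theorem restrict (h : NodeMem F γ x k) (hjk : j ≤ k) (hxy : ∀ i < j, x i = y i) :
    NodeMem F γ y j := by
  rw [NodeMem] at h ⊢
  obtain ⟨⟨z, hz, hzx⟩, h⟩ := h
  refine ⟨⟨z, hz, fun i hi => (hzx i (hi.trans_le hjk)).trans (hxy i hi)⟩, fun β hβ => ?_⟩
  obtain ⟨u, v, p, q, hp, hq, hu, hv, hr⟩ := h β hβ
  exact ⟨u, v, p, q, hjk.trans hp, hjk.trans hq,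
    fun i hi => (hu i (hi.trans_le hjk)).trans (hxy i hi),
    fun i hi => (hv i (hi.trans_le hjk)).trans (hxy i hi), hr⟩

theorem anti (h : NodeMem F γ x k) (hδ : δ ≤ γ) : NodeMem F δ x k := by
  rw [NodeMem] at h ⊢
  exact ⟨h.1, fun β hβ => h.2 β (hβ.trans_le hδ)⟩

theorem exists_mem (h : NodeMem F γ x k) : ∃ y ∈ F, ∀ i < k, y i = x i := by
  rw [NodeMem] at h
  exact h.1

end NodeMem

/-- The set of sequences `i⌢y` with `y ∈ G i`. -/
def glue (G : ℕ → Set (ℕ → ℕ)) : Set (ℕ → ℕ) := {y | (fun n => y (n + 1)) ∈ G (y 0)}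

theorem cons_mem_glue {G : ℕ → Set (ℕ → ℕ)} {i : ℕ} {y : ℕ → ℕ} (h : y ∈ G i) :
    (fun n => Nat.casesOn n i y : ℕ → ℕ) ∈ glue G := h

theorem nodeMem_glue_succ (G : ℕ → Set (ℕ → ℕ)) (γ : Ordinal.{0}) (x : ℕ → ℕ) (k : ℕ) :
    NodeMem (glue G) γ x (k + 1) ↔ NodeMem (G (x 0)) γ (fun n => x (n + 1)) k := by
  induction γ using WellFoundedLT.induction generalizing x k with
  | ind γ ih =>
    rw [NodeMem, NodeMem]
    refine and_congr ?_ (forall₂_congr fun β hβ => ?_)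
    · constructor
      · rintro ⟨y, hy, h⟩
        refine ⟨fun n => y (n + 1), ?_, fun i hi => h (i + 1) (by omega)⟩
        rw [← h 0 (by omega)]
        exact hy
      · rintro ⟨y, hy, h⟩
        refine ⟨_, cons_mem_glue hy, fun i hi => ?_⟩
        cases i with
        | zero => rfl
        | succ i => exact h i (by omega)
    · constructor
      · rintro ⟨u, v, p, q, hp, hq, hu, hv, huv, hup, hvq⟩
        obtain ⟨p, rfl⟩ : ∃ p', p = p' + 1 := ⟨p - 1, by omega⟩
        obtain ⟨q, rfl⟩ : ∃ q', q = q' + 1 := ⟨q - 1, by omega⟩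
        have hu0 := hu 0 (by omega)
        have hv0 := hv 0 (by omega)
        rw [ih β hβ, hu0] at hup
        rw [ih β hβ, hv0] at hvq
        refine ⟨_, _, p, q, by omega, by omega, fun i hi => hu (i + 1) (by omega),
          fun i hi => hv (i + 1) (by omega), fun h => huv fun i hi => ?_, hup, hvq⟩
        cases i with
        | zero => rw [hu0, hv0]
        | succ i => exact h i (by omega)
      · rintro ⟨u, v, p, q, hp, hq, hu, hv, huv, hup, hvq⟩
        refine ⟨fun n => Nat.casesOn n (x 0) u, fun n => Nat.casesOn n (x 0) v, p + 1, q + 1,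
          by omega, by omega, fun i hi => ?_, fun i hi => ?_, fun h => huv fun i hi => ?_,
          (ih β hβ _ _).2 hup, (ih β hβ _ _).2 hvq⟩
        · cases i with
          | zero => rfl
          | succ i => exact hu i (by omega)
        · cases i with
          | zero => rfl
          | succ i => exact hv i (by omega)
        · exact h (i + 1) (by omega)

/-- Every sequence has a basic neighbourhood containing at most one point of `F`. -/
def LocallySubsingleton (F : Set (ℕ → ℕ)) : Prop :=
  ∀ x : ℕ → ℕ, ∃ n, (F ∩ PiNat.cylinder x n).Subsingleton

namespace LocallySubsingleton

variable {F : Set (ℕ → ℕ)}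

theorem isClosed (hF : LocallySubsingleton F) : IsClosed F := by
  rw [← isOpen_compl_iff, isOpen_iff_mem_nhds]
  intro x hx
  obtain ⟨n, hn⟩ := hF x
  have hU : PiNat.cylinder x n ∈ 𝓝 x :=
    (PiNat.isOpen_cylinder (fun _ => ℕ) x n).mem_nhds (PiNat.self_mem_cylinder x n)
  have hV : (F ∩ PiNat.cylinder x n)ᶜ ∈ 𝓝 x :=
    hn.finite.isClosed.isOpen_compl.mem_nhds fun h => hx h.1
  filter_upwards [hU, hV] with y hy hy' hyF using hy' ⟨hyF, hy⟩

theorem not_accPt (hF : LocallySubsingleton F) {x : ℕ → ℕ} (hx : x ∈ F) :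
    ¬ AccPt x (𝓟 F) := by
  intro h
  obtain ⟨n, hn⟩ := hF x
  obtain ⟨y, ⟨hyU, hyF⟩, hne⟩ := accPt_iff_nhds.1 h _
    ((PiNat.isOpen_cylinder (fun _ => ℕ) x n).mem_nhds (PiNat.self_mem_cylinder x n))
  exact hne (hn ⟨hyF, hyU⟩ ⟨hx, PiNat.self_mem_cylinder x n⟩)

theorem countable (hF : LocallySubsingleton F) : F.Countable := by
  choose n hn using hF
  obtain ⟨s, hs, hcov⟩ := TopologicalSpace.countable_cover_nhds
    (f := fun x : ℕ → ℕ => PiNat.cylinder x (n x)) fun x =>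
      (PiNat.isOpen_cylinder (fun _ => ℕ) x (n x)).mem_nhds (PiNat.self_mem_cylinder x (n x))
  refine (hs.biUnion fun x _ => (hn x).countable).mono fun y hy => ?_
  have hy' : y ∈ ⋃ x ∈ s, PiNat.cylinder x (n x) := hcov ▸ Set.mem_univ y
  simp only [Set.mem_iUnion] at hy' ⊢
  obtain ⟨x, hx, h⟩ := hy'
  exact ⟨x, hx, hy, h⟩

end LocallySubsingleton

theorem locallySubsingleton_glue {G : ℕ → Set (ℕ → ℕ)} (hG : ∀ i, LocallySubsingleton (G i)) :
    LocallySubsingleton (glue G) := by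
  intro x
  obtain ⟨n, hn⟩ := hG (x 0) fun n => x (n + 1)
  refine ⟨n + 1, ?_⟩
  rintro y ⟨hy, hyx⟩ z ⟨hz, hzx⟩
  have hy0 : y 0 = x 0 := hyx 0 (by omega)
  have hz0 : z 0 = x 0 := hzx 0 (by omega)
  have hyG : (fun n => y (n + 1)) ∈ G (x 0) := hy0 ▸ hy
  have hzG : (fun n => z (n + 1)) ∈ G (x 0) := hz0 ▸ hz
  have := hn ⟨hyG, fun i hi => hyx (i + 1) (by omega)⟩ ⟨hzG, fun i hi => hzx (i + 1) (by omega)⟩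
  funext i
  cases i with
  | zero => rw [hy0, hz0]
  | succ i => exact congrFun this i

theorem exists_nodeMem_exactly (γ : Ordinal.{0}) (hγ : (Set.Iio γ).Countable) :
    ∃ F, LocallySubsingleton F ∧ (∀ x, NodeMem F γ x 0) ∧
      ∀ x k, ¬ NodeMem F (γ + 1) x k := by
  induction γ using WellFoundedLT.induction with
  | ind γ ih =>
    rcases eq_zero_or_pos γ with rfl | hpos
    · refine ⟨{0}, fun x => ⟨0, Set.subsingleton_singleton.anti Set.inter_subset_left⟩,
        fun x => ?_, fun x k h => ?_⟩
      · rw [NodeMem]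
        exact ⟨⟨0, rfl, by simp⟩, fun β hβ => absurd hβ not_lt_zero⟩
      · rw [NodeMem] at h
        obtain ⟨u, v, p, q, -, -, -, -, huv, hu, hv⟩ := h.2 0 (by simp)
        obtain ⟨y, rfl, hy⟩ := hu.exists_mem
        obtain ⟨z, rfl, hz⟩ := hv.exists_mem
        exact huv fun i hi => (hy i (by omega)).symm.trans (hz i (by omega))
    · have : Countable (Set.Iio γ) := hγ.to_subtype
      have : Nonempty (Set.Iio γ) := ⟨⟨0, hpos⟩⟩
      obtain ⟨f, hf⟩ := exists_surjective_nat (Set.Iio γ)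
      choose H hLS hmem hnot using fun b : Set.Iio γ =>
        ih b.1 b.2 (hγ.mono (Set.Iio_subset_Iio (le_of_lt b.2)))
      have hnode : ∀ δ x k, NodeMem (glue fun i => glue fun _ => H (f i.unpair.1)) δ x (k + 2) ↔
          NodeMem (H (f (x 0).unpair.1)) δ (fun n => x (n + 2)) k := fun δ x k => by
        rw [nodeMem_glue_succ, nodeMem_glue_succ]
      refine ⟨glue fun i => glue fun _ => H (f i.unpair.1),
        locallySubsingleton_glue fun i => locallySubsingleton_glue fun _ => hLS _,
        fun x => ?_, fun x k h => ?_⟩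
      · have hall : ∀ β < γ, ∃ i : ℕ, ∀ j, NodeMem (glue fun i => glue fun _ => H (f i.unpair.1))
            β (fun _ => Nat.pair i j) 2 := fun β hβ => by
          obtain ⟨i, hi⟩ := hf ⟨β, hβ⟩
          refine ⟨i, fun j => (hnode _ _ 0).2 ?_⟩
          simp only [Nat.unpair_pair, hi]
          exact hmem ⟨β, hβ⟩ _
        rw [NodeMem]
        refine ⟨?_, fun β hβ => ?_⟩
        · obtain ⟨i, hi⟩ := hall 0 hpos
          obtain ⟨y, hy, -⟩ := (hi 0).exists_mem
          exact ⟨y, hy, by simp⟩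
        · obtain ⟨i, hi⟩ := hall β hβ
          refine ⟨_, _, 1, 1, Nat.zero_le _, Nat.zero_le _, by simp, by simp, fun h => ?_, hi 0, hi 1⟩
          simpa using h 0 (by simp)
      · rw [NodeMem] at h
        obtain ⟨u, v, p, q, -, -, -, -, huv, hu, -⟩ := h.2 γ (Order.lt_add_one_iff.2 le_rfl)
        have hp : 1 ≤ p := by
          by_contra hp
          exact huv fun i hi => by omega
        obtain ⟨p, rfl⟩ : ∃ p', p = p' + 1 := ⟨p - 1, by omega⟩
        exact hnot _ _ _ (((hnode _ _ _).1 hu).anti (Order.add_one_le_of_lt (f _).2))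

namespace Presentation

variable (P : Presentation (ℕ → ℕ))

theorem mem_ball_iff (hP : P.dist = baireDist) (n : ℕ × ℕ) (x : ℕ → ℕ) :
    x ∈ P.ball n ↔ ∀ i < n.2 + 1, x i = P.seq n.1 i := by
  change P.dist _ _ < _ ↔ _
  rw [hP, baireDist_lt_iff]

theorem mem_cball_iff (hP : P.dist = baireDist) (n : ℕ × ℕ) (x : ℕ → ℕ) :
    x ∈ P.cball n ↔ ∀ i < n.2, x i = P.seq n.1 i := by
  change P.dist _ _ ≤ _ ↔ _
  rw [hP, baireDist_le_iff]

theorem exists_seq_eq (hP : P.dist = baireDist) (x : ℕ → ℕ) (k : ℕ) :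
    ∃ j, ∀ i < k + 1, x i = P.seq j i := by
  obtain ⟨j, hj⟩ := P.dense x ((1 / 2) ^ (k + 1)) (by positivity)
  rw [hP, baireDist_lt_iff] at hj
  exact ⟨j, hj⟩

theorem prec_iff (hP : P.dist = baireDist) (n m : ℕ × ℕ) :
    P.prec n m ↔ n.2 + 1 ≤ m.2 ∧ ∀ i < n.2 + 1, P.seq m.1 i = P.seq n.1 i := by
  refine and_congr_right fun h => ⟨fun hs => ?_, fun hs x hx => ?_⟩
  · exact (P.mem_ball_iff hP _ _).1 (hs ((P.mem_cball_iff hP _ _).2 fun _ _ => rfl))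
  · rw [mem_cball_iff P hP] at hx
    exact (P.mem_ball_iff hP _ _).2 fun i hi => (hx i (by omega)).trans (hs i hi)

theorem apart_iff (hP : P.dist = baireDist) (n m : ℕ × ℕ) :
    P.apart n m ↔ ¬ ∀ i < min n.2 m.2, P.seq n.1 i = P.seq m.1 i := by
  rw [apart, ← not_iff_not, not_not, ← ne_eq, ← Set.nonempty_iff_ne_empty]
  constructor
  · rintro ⟨x, hx, hx'⟩ i hi
    rw [mem_cball_iff P hP] at hx hx'
    exact (hx i (by omega)).symm.trans (hx' i (by omega))
  · intro h
    rcases le_total n.2 m.2 with hle | hle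
    · refine ⟨P.seq m.1, ?_, (P.mem_cball_iff hP _ _).2 fun _ _ => rfl⟩
      exact (P.mem_cball_iff hP _ _).2 fun i hi => (h i (by omega)).symm
    · refine ⟨P.seq n.1, (P.mem_cball_iff hP _ _).2 fun _ _ => rfl, ?_⟩
      exact (P.mem_cball_iff hP _ _).2 fun i hi => h i (by omega)

theorem mem_derivIter_code_iff (hP : P.dist = baireDist) (F : Set (ℕ → ℕ)) (γ : Ordinal.{0})
    (n : ℕ × ℕ) :
    n ∈ P.derivIter (P.code F) γ ↔ NodeMem F γ (P.seq n.1) (n.2 + 1) := by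
  induction γ using WellFoundedLT.induction generalizing n with
  | ind γ ih =>
    have hcode : n ∈ P.code F ↔ ∃ y ∈ F, ∀ i < n.2 + 1, y i = P.seq n.1 i := by
      simp only [code, Set.mem_ofPred_eq, Set.Nonempty, Set.mem_inter_iff, mem_ball_iff P hP,
        and_comm]
    rw [mem_derivIter_iff, NodeMem, hcode]
    refine and_congr_right fun hn => forall₂_congr fun β hβ => ⟨?_, ?_⟩
    · rintro ⟨-, u, hu, v, hv, hnu, hnv, huv⟩
      rw [prec_iff P hP] at hnu hnv
      rw [ih β hβ] at hu hv
      exact ⟨_, _, _, _, hnu.1, hnv.1, hnu.2, hnv.2, (P.apart_iff hP _ _).1 huv, hu, hv⟩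
    · rintro ⟨u, v, p, q, hp, hq, hu, hv, huv, hup, hvq⟩
      obtain ⟨a, ha⟩ := P.exists_seq_eq hP u p
      obtain ⟨b, hb⟩ := P.exists_seq_eq hP v q
      refine ⟨?_, (a, p), (ih β hβ _).2 (hup.restrict le_rfl ha), (b, q),
        (ih β hβ _).2 (hvq.restrict le_rfl hb), (P.prec_iff hP _ _).2 ⟨hp, fun i hi => ?_⟩,
        (P.prec_iff hP _ _).2 ⟨hq, fun i hi => ?_⟩,
        (P.apart_iff hP _ _).2 fun h => huv fun i hi => ?_⟩
      · exact (ih β hβ n).2 (hup.restrict (by omega) hu)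
      · exact (ha i (by omega)).symm.trans (hu i hi)
      · exact (hb i (by omega)).symm.trans (hv i hi)
      · exact (ha i (by omega)).trans ((h i hi).trans (hb i (by omega)).symm)

end Presentation

/-- For any presentation `P` of Baire space with the standard ultrametric
and every countable ordinal `α`, there is a discrete countable closed `F ⊆ ω^ω` with
`φ_P(F) = α`. -/
theorem stmt16 (P : Presentation (ℕ → ℕ)) (hP : P.dist = baireDist)
    (α : Ordinal.{0}) (hα : α.card ≤ Cardinal.aleph0) :
    ∃ F : Set (ℕ → ℕ), IsClosed F ∧ F.Countable ∧
      (∀ x ∈ F, ¬ AccPt x (𝓟 F)) ∧ P.phi F = α := by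
  have hcount : (Set.Iio α).Countable := by
    rw [← Cardinal.le_aleph0_iff_set_countable, Cardinal.mk_Iio_ordinal, Cardinal.lift_le_aleph0]
    exact hα
  suffices h : ∃ F, LocallySubsingleton F ∧ (∀ x k, ¬ NodeMem F α x (k + 1)) ∧
      ∀ β < α, ∃ x, NodeMem F β x 1 by
    obtain ⟨F, hF, hempty, hne⟩ := h
    refine ⟨F, hF.isClosed, hF.countable, fun x hx => hF.not_accPt hx,
      P.rankA_eq_of_empty _ (Set.eq_empty_of_forall_notMem fun n hn => ?_) fun β hβ => ?_⟩
    · exact hempty _ _ ((P.mem_derivIter_code_iff hP F α n).1 hn)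
    · obtain ⟨x, hx⟩ := hne β hβ
      obtain ⟨j, hj⟩ := P.exists_seq_eq hP x 0
      exact ⟨(j, 0), (P.mem_derivIter_code_iff hP F β _).2 (hx.restrict le_rfl hj)⟩
  rcases eq_zero_or_pos α with rfl | hpos
  · refine ⟨∅, fun x => ⟨0, by simp⟩, fun x k h => ?_, fun β hβ => absurd hβ not_lt_zero⟩
    obtain ⟨y, hy, -⟩ := h.exists_mem
    exact hy
  · have : Countable (Set.Iio α) := hcount.to_subtype
    have : Nonempty (Set.Iio α) := ⟨⟨0, hpos⟩⟩
    obtain ⟨f, hf⟩ := exists_surjective_nat (Set.Iio α)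
    choose H hLS hmem hnot using fun b : Set.Iio α =>
      exists_nodeMem_exactly b.1 (hcount.mono (Set.Iio_subset_Iio (le_of_lt b.2)))
    refine ⟨glue fun i => H (f i), locallySubsingleton_glue fun i => hLS _, fun x k h => ?_,
      fun β hβ => ?_⟩
    · exact hnot _ _ _ (((nodeMem_glue_succ _ _ _ _).1 h).anti (Order.add_one_le_of_lt (f _).2))
    · obtain ⟨i, hi⟩ := hf ⟨β, hβ⟩
      refine ⟨fun _ => i, (nodeMem_glue_succ _ _ _ _).2 ?_⟩
      simp only [hi]
      exact hmem ⟨β, hβ⟩ _
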